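/- Let d ≥ 1 and N ≥ 1. Index ℝ^{n(d,N)} by the set Z_N^{d+1} (where n(d,N) = C(N+d, d)). Define q_0 ∈ ℝ^{Z_N^{d+1}} by (q_0)_β = sqrt(N!/(d+1)_N) for all β, and for each 1 ≤ n ≤ N and α ∈ Z_N^{d+1} define q_{α,n} ∈ ℝ^{Z_N^{d+1}} by (q_{α,n})_β = Q_{α,n}(β; 0, N), where the parameter κ = 0 ∈ ℝ^{d+1}. Then the collection {q_0} ∪ {q_{α,n} : α ∈ Z_N^{d+1}, 1 ≤ n ≤ N}, of cardinality 1 + N·n(d,N), is a tight frame of ℝ^{Z_N^{d+1}}: for every x ∈ ℝ^{Z_N^{d+1}}, Σ_{β ∈ Z_N^{d+1}} x_β^2 = (Σ_β x_β (q_0)_β)^2 + Σ_{n=1}^{N} Σ_{α ∈ Z_N^{d+1}} (Σ_β x_β (q_{α,n})_β)^2. -/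

import Mathlib

open Finset

/-- Pochhammer symbol `(a)_k = a (a+1) ⋯ (a+k-1)`. -/
noncomputable def poch (a : ℝ) : ℕ → ℝ
  | 0 => 1
  | k + 1 => poch a k * (a + k)

/-- Multi-index Pochhammer `(x)_γ = ∏ i (x i)_{γ i}`. -/
noncomputable def pochV {m : ℕ} (x : Fin m → ℝ) (γ : Fin m → ℕ) : ℝ :=
  ∏ i, poch (x i) (γ i)

/-- Multi-index factorial `γ! = ∏ i (γ i)!` (as a real number). -/
noncomputable def mfact {m : ℕ} (γ : Fin m → ℕ) : ℝ :=
  ∏ i, (Nat.factorial (γ i) : ℝ)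

/-- Shifted monomial `m_γ(x) = (-1)^{|γ|} (-x)_γ`. -/
noncomputable def mono {m : ℕ} (γ : Fin m → ℕ) (x : Fin m → ℝ) : ℝ :=
  (-1 : ℝ) ^ (∑ i, γ i) * pochV (fun i => -(x i)) γ

/-- `Z_N^{d+1} = {α ∈ ℕ^{d+1} : |α| = N}` as a finite set. -/
def ZN (d N : ℕ) : Finset (Fin (d + 1) → ℕ) :=
  (Fintype.piFinset fun _ => Finset.range (N + 1)).filter fun α => ∑ i, α i = N

/-- `{ν ∈ ℕ^d : |ν| = n}` as a finite set. -/
def idxSet (d n : ℕ) : Finset (Fin d → ℕ) :=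
  (Fintype.piFinset fun _ => Finset.range (n + 1)).filter fun ν => ∑ i, ν i = n

/-- The finite set `{γ ∈ ℕ^m : γ ≤ α}`. -/
def below {m : ℕ} (α : Fin m → ℕ) : Finset (Fin m → ℕ) :=
  Fintype.piFinset fun i => Finset.range (α i + 1)

/-- Monic Hahn polynomial `Q_α(x; κ, N)`. -/
noncomputable def monicQ (d N : ℕ) (κ : Fin (d + 1) → ℝ) (α : Fin (d + 1) → ℕ)
    (x : Fin (d + 1) → ℝ) : ℝ :=
  poch (-(N : ℝ)) (∑ i, α i) * pochV (fun i => κ i + 1) α /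
      poch ((∑ i, κ i) + d + (∑ i, α i)) (∑ i, α i) *
    ∑ γ ∈ below α,
      pochV (fun i => -(α i : ℝ)) γ * poch ((∑ i, κ i) + d + (∑ i, α i)) (∑ i, γ i) *
          (-1 : ℝ) ^ (∑ i, γ i) /
          (mfact γ * pochV (fun i => κ i + 1) γ * poch (-(N : ℝ)) (∑ i, γ i)) *
        mono γ x

/-- One-variable Hahn polynomial `Q_n(x; a, b, M)` (a `₃F₂` sum). -/
noncomputable def hahn1 (n : ℕ) (x a b M : ℝ) : ℝ :=
  ∑ k ∈ Finset.range (n + 1),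
    poch (-(n : ℝ)) k * poch ((n : ℝ) + a + b + 1) k * poch (-x) k /
      (poch (a + 1) k * poch (-M) k * (Nat.factorial k : ℝ))

/-- The parameter `a_j = κ_{j+1}+⋯+κ_{d+1} + 2|ν^{j+1}| + d - j` (1-based `j`). -/
noncomputable def aj (d : ℕ) (κ : Fin (d + 1) → ℝ) (ν : Fin d → ℕ) (j : Fin d) : ℝ :=
  (∑ i ∈ Finset.univ.filter (fun i : Fin (d + 1) => (j : ℕ) < (i : ℕ)), κ i) +
    2 * (∑ i ∈ Finset.univ.filter (fun i : Fin d => (j : ℕ) < (i : ℕ)), (ν i : ℝ)) +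
    ((d - 1 - (j : ℕ) : ℕ) : ℝ)

/-- `|x_{j-1}| = x_1 + ⋯ + x_{j-1}` (1-based `j`). -/
noncomputable def sumLt (d : ℕ) (x : Fin (d + 1) → ℕ) (j : Fin d) : ℝ :=
  ∑ i ∈ Finset.univ.filter (fun i : Fin (d + 1) => (i : ℕ) < (j : ℕ)), (x i : ℝ)

/-- `|ν^{j+1}| = ν_{j+1} + ⋯ + ν_d` (1-based `j`). -/
noncomputable def sumGt (d : ℕ) (ν : Fin d → ℕ) (j : Fin d) : ℝ :=
  ∑ i ∈ Finset.univ.filter (fun i : Fin d => (j : ℕ) < (i : ℕ)), (ν i : ℝ)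

/-- Hahn polynomial of `d` variables `H_ν(x; κ, N)`. -/
noncomputable def hahnH (d N : ℕ) (κ : Fin (d + 1) → ℝ) (ν : Fin d → ℕ)
    (x : Fin (d + 1) → ℕ) : ℝ :=
  (-1 : ℝ) ^ (∑ i, ν i) / poch (-(N : ℝ)) (∑ i, ν i) *
    ∏ j : Fin d,
      poch (κ j.castSucc + 1) (ν j) / poch (aj d κ ν j + 1) (ν j) *
        poch (-(N : ℝ) + sumLt d x j + sumGt d ν j) (ν j) *
        hahn1 (ν j) (x j.castSucc : ℝ) (κ j.castSucc) (aj d κ ν j)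
          ((N : ℝ) - sumLt d x j - sumGt d ν j)

/-- Squared norm `B_ν(κ, N)` of the Hahn polynomial `H_ν(·; κ, N)`. -/
noncomputable def Bnorm (d N : ℕ) (κ : Fin (d + 1) → ℝ) (ν : Fin d → ℕ) : ℝ :=
  (-1 : ℝ) ^ (∑ i, ν i) * poch ((∑ i, κ i) + d + 1) (N + ∑ i, ν i) /
      (poch (-(N : ℝ)) (∑ i, ν i) * poch ((∑ i, κ i) + d + 1) N *
        poch ((∑ i, κ i) + d + 1) (2 * ∑ i, ν i)) *
    ∏ j : Fin d,
      poch (κ j.castSucc + aj d κ ν j + 1) (2 * ν j) * poch (κ j.castSucc + 1) (ν j) *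
          (Nat.factorial (ν j) : ℝ) /
        (poch (κ j.castSucc + aj d κ ν j + 1) (ν j) * poch (aj d κ ν j + 1) (ν j))

/-- Projection `Q_{α,n}(x; κ, N)` of `m_α/(κ+1)_α` onto the space of degree `n`. -/
noncomputable def monicQn (d N : ℕ) (κ : Fin (d + 1) → ℝ) (α : Fin (d + 1) → ℕ) (n : ℕ)
    (x : Fin (d + 1) → ℝ) : ℝ :=
  (-1 : ℝ) ^ (∑ i, α i) * poch (-(N : ℝ)) (∑ i, α i) * poch ((∑ i, κ i) + d + 1) (2 * n) /
      (poch (-(N : ℝ)) n * poch ((∑ i, κ i) + d + 1) ((∑ i, α i) + n)) *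
    ∑ β ∈ ZN d n,
      pochV (fun i => -(α i : ℝ)) β / (mfact β * pochV (fun i => κ i + 1) β) *
        monicQ d N κ β x

/-- The kernel `E_k(x, y; κ) = Σ_{|γ|=k} (-x)_γ (-y)_γ / (γ! (κ+1)_γ)`. -/
noncomputable def Efun (d : ℕ) (κ : Fin (d + 1) → ℝ) (x y : Fin (d + 1) → ℕ) (k : ℕ) : ℝ :=
  ∑ γ ∈ ZN d k,
    pochV (fun i => -(x i : ℝ)) γ * pochV (fun i => -(y i : ℝ)) γ /
      (mfact γ * pochV (fun i => κ i + 1) γ)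

/-- Monic Jacobi polynomial on the simplex `R_α^κ(x)`. -/
noncomputable def jacobiR (d : ℕ) (κ : Fin (d + 1) → ℝ) (α : Fin (d + 1) → ℕ)
    (x : Fin d → ℝ) : ℝ :=
  (-1 : ℝ) ^ (∑ i, α i) * pochV (fun i => κ i + 1) α /
      poch ((∑ i, κ i) + d + (∑ i, α i)) (∑ i, α i) *
    ∑ γ ∈ below α,
      pochV (fun i => -(α i : ℝ)) γ * poch ((∑ i, κ i) + d + (∑ i, α i)) (∑ i, γ i) /
          (pochV (fun i => κ i + 1) γ * mfact γ) *
        ∏ i, (Fin.snoc x (1 - ∑ i, x i) : Fin (d + 1) → ℝ) i ^ γ i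

/-- One-variable Krawtchouk polynomial `K_n(x; p, M)`. -/
noncomputable def kraw1 (n : ℕ) (x p M : ℝ) : ℝ :=
  ∑ k ∈ Finset.range (n + 1),
    poch (-(n : ℝ)) k * poch (-x) k / (poch (-M) k * (Nat.factorial k : ℝ) * p ^ k)

/-- The extended parameter `𝛒 = (ρ_1, …, ρ_d, 1 - |ρ|)`. -/
noncomputable def brho (d : ℕ) (ρ : Fin d → ℝ) : Fin (d + 1) → ℝ :=
  Fin.snoc ρ (1 - ∑ i, ρ i)

/-- `𝛒^γ = ∏ i 𝛒_i^{γ i}`. -/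
noncomputable def bpow (d : ℕ) (ρ : Fin d → ℝ) (γ : Fin (d + 1) → ℕ) : ℝ :=
  ∏ i, brho d ρ i ^ γ i

/-- `|𝛒_j| = ρ_1 + ⋯ + ρ_j` (1-based `j`). -/
noncomputable def sumLe (d : ℕ) (ρ : Fin d → ℝ) (j : Fin d) : ℝ :=
  ∑ i ∈ Finset.univ.filter (fun i : Fin d => (i : ℕ) ≤ (j : ℕ)), ρ i

/-- `|𝛒_{j-1}| = ρ_1 + ⋯ + ρ_{j-1}` (1-based `j`). -/
noncomputable def sumLtρ (d : ℕ) (ρ : Fin d → ℝ) (j : Fin d) : ℝ :=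
  ∑ i ∈ Finset.univ.filter (fun i : Fin d => (i : ℕ) < (j : ℕ)), ρ i

/-- Krawtchouk polynomial of `d` variables `K_ν(x; ρ, N)`. -/
noncomputable def krawH (d N : ℕ) (ρ : Fin d → ℝ) (ν : Fin d → ℕ)
    (x : Fin (d + 1) → ℕ) : ℝ :=
  (-1 : ℝ) ^ (∑ i, ν i) / poch (-(N : ℝ)) (∑ i, ν i) *
    ∏ j : Fin d,
      ρ j ^ ν j / (1 - sumLe d ρ j) ^ ν j *
        poch (-(N : ℝ) + sumLt d x j + sumGt d ν j) (ν j) *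
        kraw1 (ν j) (x j.castSucc : ℝ) (ρ j / (1 - sumLtρ d ρ j))
          ((N : ℝ) - sumLt d x j - sumGt d ν j)

/-- Squared norm `C_ν(ρ, N)` of the Krawtchouk polynomial `K_ν(·; ρ, N)`. -/
noncomputable def Cnorm (d N : ℕ) (ρ : Fin d → ℝ) (ν : Fin d → ℕ) : ℝ :=
  (-1 : ℝ) ^ (∑ i, ν i) / (poch (-(N : ℝ)) (∑ i, ν i) * (Nat.factorial N : ℝ)) *
    ∏ j : Fin d,
      (Nat.factorial (ν j) : ℝ) * ρ j ^ ν j /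
        (1 - sumLe d ρ j) ^ ((ν j : ℤ) - ((Fin.snoc ν 0 : Fin (d + 1) → ℕ) j.succ : ℤ))

/-- Monic Krawtchouk polynomial `L_α(x; ρ, N)`. -/
noncomputable def monicL (d N : ℕ) (ρ : Fin d → ℝ) (α : Fin (d + 1) → ℕ)
    (x : Fin (d + 1) → ℝ) : ℝ :=
  poch (-(N : ℝ)) (∑ i, α i) * bpow d ρ α *
    ∑ γ ∈ below α,
      pochV (fun i => -(α i : ℝ)) γ * (-1 : ℝ) ^ (∑ i, γ i) /
          (mfact γ * poch (-(N : ℝ)) (∑ i, γ i) * bpow d ρ γ) *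
        mono γ x

/-- Projection `L_{α,n}(x; ρ, N)` of `m_α/𝛒^α` onto the space of degree `n`. -/
noncomputable def monicLn (d N : ℕ) (ρ : Fin d → ℝ) (α : Fin (d + 1) → ℕ) (n : ℕ)
    (x : Fin (d + 1) → ℝ) : ℝ :=
  (-1 : ℝ) ^ (∑ i, α i) * poch (-(N : ℝ)) (∑ i, α i) / poch (-(N : ℝ)) n *
    ∑ β ∈ ZN d n,
      pochV (fun i => -(α i : ℝ)) β / (mfact β * bpow d ρ β) * monicL d N ρ β x

/-- The kernel `F_k(x, y; ρ) = Σ_{|γ|=k} (-x)_γ (-y)_γ / (γ! 𝛒^γ)`. -/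
noncomputable def Ffun (d : ℕ) (ρ : Fin d → ℝ) (x y : Fin (d + 1) → ℕ) (k : ℕ) : ℝ :=
  ∑ γ ∈ ZN d k,
    pochV (fun i => -(x i : ℝ)) γ * pochV (fun i => -(y i : ℝ)) γ / (mfact γ * bpow d ρ γ)

theorem mem_ZN {d N : ℕ} {α : Fin (d + 1) → ℕ} : α ∈ ZN d N ↔ ∑ i, α i = N := by
  simp only [ZN, mem_filter, Fintype.mem_piFinset, mem_range, and_iff_right_iff_imp]
  intro h i
  have := single_le_sum (f := α) (fun _ _ => Nat.zero_le _) (mem_univ i)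
  omega

/-- The product of binomial coefficients `∏ i, (x i).choose (γ i)`. -/
noncomputable def mchoose {m : ℕ} (x γ : Fin m → ℕ) : ℝ :=
  ∏ i, ((x i).choose (γ i) : ℝ)

/-- The raising operator `f ↦ ∑ j, (γ_j + 1) f(γ + e_j)`. -/
noncomputable def raise {m : ℕ} (f : (Fin m → ℕ) → ℝ) (γ : Fin m → ℕ) : ℝ :=
  ∑ j, ((γ j : ℝ) + 1) * f (Function.update γ j (γ j + 1))

/-- The lowering operator `f ↦ ∑ j, x_j f(x - e_j)`. -/
noncomputable def lower {m : ℕ} (f : (Fin m → ℕ) → ℝ) (x : Fin m → ℕ) : ℝ :=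
  ∑ j, (x j : ℝ) * f (Function.update x j (x j - 1))

theorem mchoose_update_left {m : ℕ} (x γ : Fin m → ℕ) (j : Fin m) (v : ℕ) :
    mchoose (Function.update x j v) γ =
      (v.choose (γ j) : ℝ) * ∏ i ∈ univ.erase j, ((x i).choose (γ i) : ℝ) := by
  rw [mchoose, ← mul_prod_erase _ _ (mem_univ j), Function.update_self]
  congr 1
  refine prod_congr rfl fun i hi => ?_
  rw [Function.update_of_ne (ne_of_mem_erase hi)]

theorem mchoose_update_right {m : ℕ} (x γ : Fin m → ℕ) (j : Fin m) (v : ℕ) :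
    mchoose x (Function.update γ j v) =
      ((x j).choose v : ℝ) * ∏ i ∈ univ.erase j, ((x i).choose (γ i) : ℝ) := by
  rw [mchoose, ← mul_prod_erase _ _ (mem_univ j), Function.update_self]
  congr 1
  refine prod_congr rfl fun i hi => ?_
  rw [Function.update_of_ne (ne_of_mem_erase hi)]

theorem mchoose_eq_mul_prod_erase {m : ℕ} (x γ : Fin m → ℕ) (j : Fin m) :
    mchoose x γ = ((x j).choose (γ j) : ℝ) * ∏ i ∈ univ.erase j, ((x i).choose (γ i) : ℝ) := by
  rw [mchoose, ← mul_prod_erase _ _ (mem_univ j)]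

theorem succ_mul_choose_succ_right (y g : ℕ) :
    ((g : ℝ) + 1) * (y.choose (g + 1) : ℝ) = ((y : ℝ) - g) * y.choose g := by
  rcases le_or_gt g y with h | h
  · have := Nat.choose_succ_right_eq y g
    rw [← Nat.cast_sub h]
    exact_mod_cast by linarith
  · simp [Nat.choose_eq_zero_of_lt h, Nat.choose_eq_zero_of_lt (h.trans (Nat.lt_succ_self g))]

theorem mul_choose_pred_left (x g : ℕ) :
    (x : ℝ) * ((x - 1).choose g : ℝ) = ((x : ℝ) - g) * x.choose g := by
  cases x with
  | zero => cases g <;> simp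
  | succ x =>
    rw [← succ_mul_choose_succ_right, Nat.add_sub_cancel]
    have := Nat.add_one_mul_choose_eq x g
    exact_mod_cast by linarith

theorem succ_mul_choose_succ_left (a g : ℕ) :
    ((a : ℝ) + 1) * ((a + 1).choose g : ℝ) =
      ((a : ℝ) + 1 + g) * a.choose g + g * a.choose (g - 1) := by
  cases g with
  | zero => simp
  | succ g =>
    have h1 := succ_mul_choose_succ_right a g
    rw [Nat.choose_succ_succ, Nat.add_sub_cancel]
    push_cast
    linarith

theorem raise_mchoose_right {m : ℕ} (y γ : Fin m → ℕ) :
    raise (mchoose y) γ = ((∑ i, y i : ℕ) - (∑ i, γ i : ℕ) : ℝ) * mchoose y γ := by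
  push_cast
  rw [← sum_sub_distrib, sum_mul]
  refine sum_congr rfl fun j _ => ?_
  rw [mchoose_update_right, mchoose_eq_mul_prod_erase y γ j, ← mul_assoc, ← mul_assoc,
    succ_mul_choose_succ_right]

theorem lower_mchoose_left {m : ℕ} (γ x : Fin m → ℕ) :
    lower (fun z => mchoose z γ) x =
      ((∑ i, x i : ℕ) - (∑ i, γ i : ℕ) : ℝ) * mchoose x γ := by
  push_cast
  rw [← sum_sub_distrib, sum_mul]
  refine sum_congr rfl fun j _ => ?_
  beta_reduce
  rw [mchoose_update_left, mchoose_eq_mul_prod_erase x γ j, ← mul_assoc, ← mul_assoc,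
    mul_choose_pred_left]

theorem raise_mchoose_left {m : ℕ} (γ x : Fin m → ℕ) :
    raise (fun z => mchoose z γ) x =
      ((∑ i, x i : ℕ) + m + (∑ i, γ i : ℕ) : ℝ) * mchoose x γ + lower (mchoose x) γ := by
  have hm : ((∑ i, x i : ℕ) + m + (∑ i, γ i : ℕ) : ℝ) = ∑ i, ((x i : ℝ) + 1 + γ i) := by
    simp [sum_add_distrib]
  rw [hm, sum_mul, lower, ← sum_add_distrib]
  refine sum_congr rfl fun j _ => ?_
  beta_reduce
  rw [mchoose_update_left, mchoose_update_right, mchoose_eq_mul_prod_erase x γ j, ← mul_assoc,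
    ← mul_assoc, ← mul_assoc, ← add_mul, succ_mul_choose_succ_left]

/-- The raising and lowering operators are adjoint to each other. -/
theorem sum_lower_mul {d N : ℕ} (h g : (Fin (d + 1) → ℕ) → ℝ) :
    ∑ x ∈ ZN d (N + 1), lower h x * g x = ∑ γ ∈ ZN d N, h γ * raise g γ := by
  simp only [lower, raise, sum_mul, mul_sum]
  rw [sum_comm, sum_comm (s := ZN d N)]
  refine sum_congr rfl fun j _ => ?_
  have hsum (γ : Fin (d + 1) → ℕ) (v : ℕ) :
      ∑ i, Function.update γ j v i + γ j = ∑ i, γ i + v := by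
    rw [sum_update_of_mem (mem_univ j), sum_eq_add_sum_sdiff_singleton_of_mem (mem_univ j) γ]
    ring
  rw [← sum_filter_of_ne (p := fun x : Fin (d + 1) → ℕ => x j ≠ 0)]
  · refine sum_nbij' (fun x => Function.update x j (x j - 1))
      (fun γ => Function.update γ j (γ j + 1)) ?_ ?_ ?_ ?_ ?_
    · intro x hx
      simp only [mem_filter, mem_ZN] at hx ⊢
      have := hsum x (x j - 1)
      omega
    · intro γ hγ
      simp only [mem_filter, mem_ZN] at hγ ⊢
      have := hsum γ (γ j + 1)
      simp
      omega
    · intro x hx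
      simp only [mem_filter] at hx
      simp [Nat.sub_add_cancel (Nat.pos_of_ne_zero hx.2)]
    · intro γ _
      simp
    · intro x hx
      simp only [mem_filter] at hx
      have := Nat.sub_add_cancel (Nat.pos_of_ne_zero hx.2)
      have h' : ((x j - 1 : ℕ) : ℝ) + 1 = x j := by exact_mod_cast this
      simp [this, h']
      ring
  · intro x _ hx h0
    simp [h0] at hx

theorem mchoose_self {m : ℕ} (x : Fin m → ℕ) : mchoose x x = 1 := by
  simp [mchoose]

theorem mchoose_eq_zero {m : ℕ} {x γ : Fin m → ℕ} (h : ¬ γ ≤ x) : mchoose x γ = 0 := by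
  rw [Pi.le_def, not_forall] at h
  obtain ⟨i, hi⟩ := h
  exact prod_eq_zero (mem_univ i) (by rw [Nat.choose_eq_zero_of_lt (not_le.mp hi), Nat.cast_zero])

theorem mchoose_eq_ite {m : ℕ} {x γ : Fin m → ℕ} (h : ∑ i, x i = ∑ i, γ i) :
    mchoose x γ = if x = γ then 1 else 0 := by
  split_ifs with hx
  · rw [hx, mchoose_self]
  · refine mchoose_eq_zero fun hle => hx ?_
    have := (sum_eq_sum_iff_of_le (fun i _ => hle i)).mp h.symm
    exact funext fun i => (this i (mem_univ i)).symm

/-- The kernel `∑_{|γ| = k} C(x, γ) C(y, γ)`. -/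
noncomputable def chooseKernel (d k : ℕ) (x y : Fin (d + 1) → ℕ) : ℝ :=
  ∑ γ ∈ ZN d k, mchoose x γ * mchoose y γ

theorem chooseKernel_top {d N : ℕ} {x y : Fin (d + 1) → ℕ} (hx : x ∈ ZN d N) (hy : y ∈ ZN d N) :
    chooseKernel d N x y = if x = y then 1 else 0 := by
  rw [chooseKernel, sum_eq_single_of_mem x hx, mchoose_self, one_mul, mchoose_eq_ite]
  · simp only [eq_comm]
  · rw [mem_ZN.mp hx, mem_ZN.mp hy]
  · intro γ hγ hne
    rw [mchoose_eq_ite (by rw [mem_ZN.mp hx, mem_ZN.mp hγ]), if_neg hne.symm, zero_mul]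

theorem raise_sum {m : ℕ} {ι : Type*} (s : Finset ι) (c : ι → ℝ)
    (f : ι → (Fin m → ℕ) → ℝ) (x : Fin m → ℕ) :
    raise (fun z => ∑ i ∈ s, c i * f i z) x = ∑ i ∈ s, c i * raise (f i) x := by
  simp only [raise, mul_sum]
  rw [sum_comm]
  exact sum_congr rfl fun _ _ => sum_congr rfl fun _ _ => by ring

theorem lower_sum {m : ℕ} {ι : Type*} (s : Finset ι) (c : ι → ℝ)
    (f : ι → (Fin m → ℕ) → ℝ) (x : Fin m → ℕ) :
    lower (fun z => ∑ i ∈ s, c i * f i z) x = ∑ i ∈ s, c i * lower (f i) x := by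
  simp only [lower, mul_sum]
  rw [sum_comm]
  exact sum_congr rfl fun _ _ => sum_congr rfl fun _ _ => by ring

theorem chooseKernel_zero (d : ℕ) (x y : Fin (d + 1) → ℕ) : chooseKernel d 0 x y = 1 := by
  have h : ZN d 0 = {0} := by
    ext γ
    simp [mem_ZN, funext_iff]
  simp [chooseKernel, h, mchoose]

theorem chooseKernel_comm (d k : ℕ) (x y : Fin (d + 1) → ℕ) :
    chooseKernel d k x y = chooseKernel d k y x :=
  sum_congr rfl fun _ _ => mul_comm _ _

theorem lower_chooseKernel (d k : ℕ) (x y : Fin (d + 1) → ℕ) :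
    lower (fun z => chooseKernel d k y z) x = ((∑ i, x i : ℕ) - k : ℝ) * chooseKernel d k y x := by
  simp only [chooseKernel]
  rw [lower_sum (f := fun γ z => mchoose z γ), mul_sum]
  refine sum_congr rfl fun γ hγ => ?_
  rw [lower_mchoose_left, mem_ZN.mp hγ]
  ring

theorem raise_chooseKernel_zero (d : ℕ) (x y : Fin (d + 1) → ℕ) :
    raise (fun z => chooseKernel d 0 y z) x =
      ((∑ i, x i : ℕ) + d + 1 : ℝ) * chooseKernel d 0 y x := by
  simp [chooseKernel_zero, raise, sum_add_distrib, add_assoc]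

theorem raise_chooseKernel_succ (d k : ℕ) (x y : Fin (d + 1) → ℕ) :
    raise (fun z => chooseKernel d (k + 1) y z) x =
      ((∑ i, x i : ℕ) + d + 1 + (k + 1) : ℝ) * chooseKernel d (k + 1) y x +
        ((∑ i, y i : ℕ) - k : ℝ) * chooseKernel d k y x := by
  simp only [chooseKernel]
  rw [raise_sum (f := fun γ z => mchoose z γ)]
  have h : ∑ γ ∈ ZN d (k + 1), mchoose y γ * lower (mchoose x) γ =
      ((∑ i, y i : ℕ) - k : ℝ) * ∑ γ ∈ ZN d k, mchoose y γ * mchoose x γ := by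
    simp only [mul_comm (mchoose y _)]
    rw [sum_lower_mul, mul_sum]
    refine sum_congr rfl fun γ hγ => ?_
    rw [raise_mchoose_right, mem_ZN.mp hγ]
    ring
  rw [← h, mul_sum, ← sum_add_distrib]
  refine sum_congr rfl fun γ hγ => ?_
  rw [raise_mchoose_left, mem_ZN.mp hγ]
  push_cast
  ring

theorem poch_succ (a : ℝ) (k : ℕ) : poch a (k + 1) = poch a k * (a + k) := rfl

theorem poch_add (a : ℝ) (m n : ℕ) : poch a (m + n) = poch a m * poch (a + m) n := by
  induction n with
  | zero => simp [poch]
  | succ n ih =>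
    rw [← add_assoc, poch_succ, ih, poch_succ]
    push_cast
    ring

theorem poch_succ' (a : ℝ) (k : ℕ) : poch a (k + 1) = a * poch (a + 1) k := by
  rw [add_comm, poch_add]
  simp [poch]

theorem poch_pos {a : ℝ} (ha : 0 < a) (k : ℕ) : 0 < poch a k := by
  induction k with
  | zero => exact one_pos
  | succ k ih => exact mul_pos ih (by positivity)

theorem poch_one (k : ℕ) : poch 1 k = (k.factorial : ℝ) := by
  induction k with
  | zero => simp [poch]
  | succ k ih =>
    rw [poch_succ, ih, Nat.factorial_succ]
    push_cast
    ring

theorem poch_neg (a k : ℕ) :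
    poch (-(a : ℝ)) k = (-1) ^ k * (k.factorial : ℝ) * (a.choose k : ℝ) := by
  induction k with
  | zero => simp [poch]
  | succ k ih =>
    rw [poch_succ, ih, Nat.factorial_succ, pow_succ]
    push_cast
    linear_combination (-1) ^ k * (k.factorial : ℝ) * succ_mul_choose_succ_right a k

theorem poch_neg_ne_zero {a k : ℕ} (h : k ≤ a) : poch (-(a : ℝ)) k ≠ 0 := by
  rw [poch_neg]
  have := (Nat.choose_pos h).ne'
  have := k.factorial_ne_zero
  simp [*]

theorem poch_neg_eq_zero {a k : ℕ} (h : a < k) : poch (-(a : ℝ)) k = 0 := by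
  rw [poch_neg, Nat.choose_eq_zero_of_lt h, Nat.cast_zero, mul_zero]

theorem poch_neg_succ_mul (n k : ℕ) :
    ((n : ℝ) + 1 - k) * poch (-((n + 1 : ℕ) : ℝ)) k = (n + 1) * poch (-(n : ℝ)) k := by
  have h1 := poch_succ (-((n + 1 : ℕ) : ℝ)) k
  have h2 := poch_succ' (-((n + 1 : ℕ) : ℝ)) k
  have h3 : -((n + 1 : ℕ) : ℝ) + 1 = -(n : ℝ) := by push_cast; ring
  rw [h3] at h2
  rw [h2] at h1
  push_cast at h1 ⊢
  linarith

theorem mfact_pos {m : ℕ} (γ : Fin m → ℕ) : 0 < mfact γ :=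
  prod_pos fun _ _ => by positivity

theorem pochV_neg {m : ℕ} (α γ : Fin m → ℕ) :
    pochV (fun i => -(α i : ℝ)) γ = (-1) ^ (∑ i, γ i) * mfact γ * mchoose α γ := by
  simp only [pochV, mfact, mchoose, poch_neg, prod_mul_distrib, prod_pow_eq_pow_sum]

theorem pochV_zero_add_one {m : ℕ} (γ : Fin m → ℕ) :
    pochV (fun _ => (0 : ℝ) + 1) γ = mfact γ := by
  simp only [pochV, mfact, zero_add, poch_one]

theorem mono_natCast {m : ℕ} (γ x : Fin m → ℕ) :
    mono γ (fun i => (x i : ℝ)) = mfact γ * mchoose x γ := by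
  rw [mono, pochV_neg, ← mul_assoc, ← mul_assoc, ← mul_pow]
  simp

/-- A multivariate Vandermonde identity. -/
theorem sum_mchoose_mul_mchoose {d N k : ℕ} (hk : k ≤ N) {α γ : Fin (d + 1) → ℕ}
    (hα : α ∈ ZN d N) (hγ : γ ∈ ZN d k) (n : ℕ) :
    ∑ β ∈ ZN d n, mchoose α β * mchoose β γ =
      (-1) ^ n * poch (-(n : ℝ)) k * poch (-(N : ℝ)) n /
        (poch (-(N : ℝ)) k * (n.factorial : ℝ)) * mchoose α γ := by
  have hN := poch_neg_ne_zero hk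
  have hdiag : ∑ β ∈ ZN d k, mchoose α β * mchoose β γ =
      (-1) ^ k * poch (-(k : ℝ)) k * poch (-(N : ℝ)) k /
        (poch (-(N : ℝ)) k * (k.factorial : ℝ)) * mchoose α γ := by
    have h1 : (-1 : ℝ) ^ k * poch (-(k : ℝ)) k = k.factorial := by
      rw [poch_neg, ← mul_assoc, ← mul_assoc, ← mul_pow]
      simp
    have hf := k.factorial_ne_zero
    rw [h1, sum_eq_single_of_mem γ hγ, mchoose_self]
    · field_simp
    · intro β hβ hne
      rw [mchoose_eq_ite (x := β) (by rw [mem_ZN.mp hβ, mem_ZN.mp hγ]), if_neg hne, mul_zero]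
  induction n with
  | zero =>
    rcases eq_or_ne k 0 with rfl | hkn
    · exact hdiag
    rw [poch_neg_eq_zero (Nat.pos_of_ne_zero hkn)]
    simp only [mul_zero, zero_mul, zero_div]
    refine sum_eq_zero fun β hβ => ?_
    rw [mchoose_eq_zero (x := β), mul_zero]
    intro hle
    have := sum_le_sum fun i (_ : i ∈ univ) => hle i
    rw [mem_ZN.mp hβ, mem_ZN.mp hγ] at this
    omega
  | succ n ih =>
    rcases eq_or_ne (n + 1) k with rfl | hkn
    · exact hdiag
    have hrec : ((n : ℝ) + 1 - k) * ∑ β ∈ ZN d (n + 1), mchoose α β * mchoose β γ =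
        ((N : ℝ) - n) * ∑ β ∈ ZN d n, mchoose α β * mchoose β γ := by
      have h := sum_lower_mul (d := d) (N := n) (fun z => mchoose z γ) (mchoose α)
      rw [mul_sum, mul_sum]
      convert h using 1
      · refine sum_congr rfl fun β hβ => ?_
        rw [lower_mchoose_left, mem_ZN.mp hβ, mem_ZN.mp hγ]
        push_cast
        ring
      · refine sum_congr rfl fun β hβ => ?_
        rw [raise_mchoose_right, mem_ZN.mp hβ, mem_ZN.mp hα]
        ring
    have hne : (n : ℝ) + 1 - k ≠ 0 := by
      rw [sub_ne_zero]
      exact_mod_cast hkn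
    refine mul_left_cancel₀ hne ?_
    rw [hrec]
    have hp := poch_neg_succ_mul n k
    have hfac : ((n + 1).factorial : ℝ) = (n + 1) * n.factorial := by
      exact_mod_cast n.factorial_succ
    have hf : (n.factorial : ℝ) ≠ 0 := by positivity
    have hn : (n : ℝ) + 1 ≠ 0 := by positivity
    rw [ih, hfac, poch_succ (-(N : ℝ)) n, pow_succ]
    field_simp
    linear_combination (-(N : ℝ) + n) * poch (-(N : ℝ)) n * mchoose α γ * hp

/-- Coefficient of the `k`-th binomial kernel in the reproducing kernel of degree `n`. -/
noncomputable def projCoeff (d N n k : ℕ) : ℝ :=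
  N.factorial * poch ((d : ℝ) + 1) (2 * n) * poch (-(N : ℝ)) n * poch (-(n : ℝ)) k *
      poch ((d : ℝ) + n) k /
    (poch ((d : ℝ) + 1) (N + n) * poch ((d : ℝ) + n) n * poch (-(N : ℝ)) k ^ 2 * n.factorial)

/-- Reproducing kernel of the degree `n` Hahn polynomials with parameter `0` on `Z_N^{d+1}`. -/
noncomputable def projKernel (d N n : ℕ) (x y : Fin (d + 1) → ℕ) : ℝ :=
  ∑ k ∈ range (N + 1), projCoeff d N n k * chooseKernel d k x y

theorem projKernel_comm (d N n : ℕ) (x y : Fin (d + 1) → ℕ) :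
    projKernel d N n x y = projKernel d N n y x := by
  simp only [projKernel, chooseKernel_comm d _ x y]

theorem sum_below {d n N : ℕ} (hn : n ≤ N) {β : Fin (d + 1) → ℕ} (hβ : β ∈ ZN d n)
    (F : (Fin (d + 1) → ℕ) → ℝ) (hF : ∀ γ, ¬ γ ≤ β → F γ = 0) :
    ∑ γ ∈ below β, F γ = ∑ k ∈ range (N + 1), ∑ γ ∈ ZN d k, F γ := by
  rw [← sum_fiberwise_of_maps_to (s := below β) (t := range (N + 1)) (g := fun γ => ∑ i, γ i)]
  · refine sum_congr rfl fun k _ => sum_subset ?_ ?_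
    · intro γ hγ
      exact mem_ZN.mpr (mem_filter.mp hγ).2
    · intro γ hγ hγ'
      refine hF γ fun hle => hγ' (mem_filter.mpr ⟨?_, mem_ZN.mp hγ⟩)
      simp only [below, Fintype.mem_piFinset, mem_range]
      exact fun i => Nat.lt_succ_of_le (hle i)
  · intro γ hγ
    simp only [below, Fintype.mem_piFinset, mem_range] at hγ
    have := sum_le_sum fun i (_ : i ∈ univ) => Nat.le_of_lt_succ (hγ i)
    rw [mem_ZN.mp hβ] at this
    exact mem_range.mpr (by omega)

theorem monicQ_zero_natCast {d N n : ℕ} (hn : n ≤ N) {β : Fin (d + 1) → ℕ} (hβ : β ∈ ZN d n)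
    (x : Fin (d + 1) → ℕ) :
    monicQ d N (fun _ => 0) β (fun i => (x i : ℝ)) =
      poch (-(N : ℝ)) n * mfact β / poch ((d : ℝ) + n) n *
        ∑ k ∈ range (N + 1), ∑ γ ∈ ZN d k,
          poch ((d : ℝ) + n) k / poch (-(N : ℝ)) k * (mchoose β γ * mchoose x γ) := by
  simp only [monicQ, pochV_zero_add_one]
  simp only [mem_ZN.mp hβ, sum_const_zero, zero_add]
  congr 1
  rw [sum_below hn hβ]
  · refine sum_congr rfl fun k _ => sum_congr rfl fun γ hγ => ?_
    have hs : (-1 : ℝ) ^ k * (-1) ^ k = 1 := by rw [← mul_pow]; simp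
    have := (mfact_pos γ).ne'
    rw [pochV_neg, mono_natCast, mem_ZN.mp hγ]
    by_cases h0 : poch (-(N : ℝ)) k = 0
    · simp [h0]
    field_simp
    linear_combination mchoose β γ * poch ((d : ℝ) + n) k * mchoose x γ * hs
  · intro γ hγ
    rw [pochV_neg, mchoose_eq_zero hγ]
    simp

theorem monicQn_eq_projKernel {d N n : ℕ} (hd : 1 ≤ d) (hn : n ≤ N) {α : Fin (d + 1) → ℕ}
    (hα : α ∈ ZN d N) (x : Fin (d + 1) → ℕ) :
    monicQn d N (fun _ => 0) α n (fun i => (x i : ℝ)) = projKernel d N n α x := by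
  have hd' : (0 : ℝ) < d := by exact_mod_cast hd
  have hdn := (poch_pos (a := (d : ℝ) + n) (by positivity) n).ne'
  have hdN := (poch_pos (a := (d : ℝ) + 1) (by positivity) (N + n)).ne'
  have hNn := poch_neg_ne_zero hn
  have hf : (n.factorial : ℝ) ≠ 0 := by positivity
  have hs : (-1 : ℝ) ^ (N * 2) * (-1) ^ (n * 2) = 1 := by simp [pow_mul']
  have hβ : ∑ β ∈ ZN d n, pochV (fun i => -(α i : ℝ)) β /
        (mfact β * pochV (fun _ => (0 : ℝ) + 1) β) * monicQ d N (fun _ => 0) β (fun i => (x i : ℝ)) =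
      ∑ k ∈ range (N + 1), ∑ γ ∈ ZN d k,
        (-1) ^ n * poch (-(N : ℝ)) n / poch ((d : ℝ) + n) n *
          (poch ((d : ℝ) + n) k / poch (-(N : ℝ)) k * mchoose x γ) *
          ∑ β ∈ ZN d n, mchoose α β * mchoose β γ := by
    simp only [mul_sum]
    rw [sum_congr rfl fun k _ => sum_comm, sum_comm]
    refine sum_congr rfl fun β hβ => ?_
    have := (mfact_pos β).ne'
    rw [monicQ_zero_natCast hn hβ, pochV_zero_add_one, pochV_neg, mem_ZN.mp hβ]
    simp only [mul_sum]
    refine sum_congr rfl fun k _ => sum_congr rfl fun γ _ => ?_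
    field_simp
  have hN : poch (-(N : ℝ)) N = (-1) ^ N * N.factorial := by simp [poch_neg]
  rw [monicQn, hβ, mem_ZN.mp hα, projKernel, mul_sum]
  simp only [sum_const_zero, zero_add]
  refine sum_congr rfl fun k hk => ?_
  have hkN : k ≤ N := Nat.le_of_lt_succ (mem_range.mp hk)
  have hNk := poch_neg_ne_zero hkN
  rw [chooseKernel, mul_sum, mul_sum]
  refine sum_congr rfl fun γ hγ => ?_
  rw [sum_mchoose_mul_mchoose hkN hα hγ, projCoeff, hN]
  field_simp
  linear_combination poch ((d : ℝ) + 1) (2 * n) * poch ((d : ℝ) + n) k * mchoose x γ *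
    poch (-(n : ℝ)) k * mchoose α γ * hs

theorem sum_projCoeff {d N k : ℕ} (hd : 1 ≤ d) (hk : k ≤ N) :
    ∑ n ∈ range (N + 1), projCoeff d N n k = if k = N then 1 else 0 := by
  have hd' : (0 : ℝ) < d := by exact_mod_cast hd
  split_ifs with h
  · subst h
    rw [sum_eq_single_of_mem k (self_mem_range_succ k)]
    · have h1 := (poch_pos (a := (d : ℝ) + k) (by positivity) k).ne'
      have h2 := (poch_pos (a := (d : ℝ) + 1) (by positivity) (2 * k)).ne'
      have h3 := poch_neg_ne_zero (le_refl k)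
      rw [projCoeff, ← two_mul]
      field_simp
    · intro n hn hne
      rw [projCoeff, poch_neg_eq_zero (a := n) (k := k)]
      · simp
      · have := mem_range.mp hn
        omega
  · have hkN : (k : ℝ) - N ≠ 0 := by
      rw [sub_ne_zero]
      exact_mod_cast h
    have hNk := poch_neg_ne_zero hk
    set G : ℕ → ℝ := fun n => N.factorial / (d * poch (-(N : ℝ)) k ^ 2) *
      (poch (-(N : ℝ)) n * poch d (n + k) * (n - k) * poch (-(n : ℝ)) k * (d + N + n) /
        (poch ((d : ℝ) + 1) (N + n) * n.factorial)) with hG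
    have hstep : ∀ n, ((k : ℝ) - N) * projCoeff d N n k = G (n + 1) - G n := by
      intro n
      have h1 := (poch_pos (a := (d : ℝ) + n) (by positivity) n).ne'
      have h2 := (poch_pos (a := (d : ℝ) + 1) (by positivity) (N + n)).ne'
      have h3 := (poch_pos hd' n).ne'
      have h4 : poch (d : ℝ) n * (d * poch ((d : ℝ) + 1) (2 * n)) =
          poch (d : ℝ) n * ((d + 2 * n) * (poch d n * poch ((d : ℝ) + n) n)) := by
        rw [← poch_succ', poch_succ, two_mul, poch_add]
        push_cast
        ring
      have h5 : poch ((d : ℝ) + 1) (2 * n) =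
          (d + 2 * n) * (poch d n * poch ((d : ℝ) + n) n) / d := by
        rw [eq_div_iff hd'.ne', mul_comm]
        exact mul_left_cancel₀ h3 h4
      have hfac : ((n + 1).factorial : ℝ) = (n + 1) * n.factorial := by
        exact_mod_cast n.factorial_succ
      have hf : (n.factorial : ℝ) ≠ 0 := by positivity
      have hn : (n : ℝ) + 1 ≠ 0 := by positivity
      have h6 : (d : ℝ) + 1 + (N + n : ℕ) ≠ 0 := by positivity
      have h7 : G (n + 1) = N.factorial / (d * poch (-(N : ℝ)) k ^ 2) *
          (poch (-(N : ℝ)) n * (-N + n) * (poch d (n + k) * (d + n + k)) * poch (-(n : ℝ)) k /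
            (poch ((d : ℝ) + 1) (N + n) * n.factorial)) := by
        simp only [hG]
        have hp := poch_neg_succ_mul n k
        rw [hfac, ← add_assoc N, poch_succ _ (N + n), poch_succ (-(N : ℝ)), add_right_comm n 1 k,
          poch_succ (d : ℝ)]
        have e : ((d : ℝ) + N + (n + 1 : ℕ)) = (d : ℝ) + 1 + (N + n : ℕ) := by push_cast; ring
        have e2 : ((n + 1 : ℕ) : ℝ) - k = (n : ℝ) + 1 - k := by push_cast; ring
        have e3 : (d : ℝ) + (n + k : ℕ) = d + n + k := by push_cast; ring
        rw [e, e2, e3, mul_assoc (_ * _) ((n : ℝ) + 1 - k), hp]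
        field_simp
      rw [h7, projCoeff, h5]
      simp only [hG]
      rw [poch_add (d : ℝ) n k]
      field_simp
      ring
    refine mul_left_cancel₀ hkN ?_
    rw [mul_sum, sum_congr rfl fun n _ => hstep n, sum_range_sub, mul_zero]
    have hG1 : G (N + 1) = 0 := by
      simp [hG, poch_neg_eq_zero (Nat.lt_succ_self N)]
    have hG0 : G 0 = 0 := by
      rcases Nat.eq_zero_or_pos k with h0 | h0
      · simp [hG, h0]
      · have := poch_neg_eq_zero h0
        simp only [hG, this]
        simp
    rw [hG1, hG0, sub_zero]

theorem sum_projKernel {d N : ℕ} (hd : 1 ≤ d) {x y : Fin (d + 1) → ℕ} (hx : x ∈ ZN d N)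
    (hy : y ∈ ZN d N) :
    ∑ n ∈ range (N + 1), projKernel d N n x y = if x = y then 1 else 0 := by
  simp only [projKernel]
  rw [sum_comm, ← chooseKernel_top hx hy]
  simp only [← sum_mul]
  rw [sum_eq_single_of_mem N (self_mem_range_succ N), sum_projCoeff hd le_rfl, if_pos rfl, one_mul]
  intro k hk hne
  rw [sum_projCoeff hd (Nat.le_of_lt_succ (mem_range.mp hk)), if_neg hne, zero_mul]

theorem projKernel_zero (d N : ℕ) (x y : Fin (d + 1) → ℕ) :
    projKernel d N 0 x y = N.factorial / poch ((d : ℝ) + 1) N := by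
  rw [projKernel, sum_eq_single_of_mem 0 (by simp)]
  · simp [projCoeff, chooseKernel_zero, poch]
  · intro k _ hk
    rw [projCoeff, poch_neg_eq_zero (Nat.pos_of_ne_zero hk)]
    simp

theorem projCoeff_rec {d N n k : ℕ} (hn : n ≤ N) (hk : k ≤ N) :
    ((N : ℝ) - k) * (projCoeff d N n k * (N + d + k) + projCoeff d N n (k + 1) * (N - k)) =
      ((N : ℝ) - n) * (N + n + d) * projCoeff d N n k := by
  rcases hk.eq_or_lt with rfl | hk
  · rcases hn.eq_or_lt with rfl | hn
    · simp
    · have : projCoeff d k n k = 0 := by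
        rw [projCoeff, poch_neg_eq_zero hn]
        simp
      simp [this]
  · have hNk : (-(N : ℝ) + k) ≠ 0 := by
      rw [neg_add_eq_sub, sub_ne_zero]
      exact_mod_cast hk.ne
    have h : projCoeff d N n (k + 1) * (N - k) ^ 2 =
        projCoeff d N n k * ((-n + k) * (d + n + k)) := by
      rw [projCoeff, projCoeff, poch_succ, poch_succ, poch_succ, mul_pow]
      have e : ((N : ℝ) - k) ^ 2 = (-(N : ℝ) + k) ^ 2 := by ring
      rw [e, div_mul_eq_mul_div, div_mul_eq_mul_div]
      refine Eq.trans ?_ (mul_div_mul_right _ _ (pow_ne_zero 2 hNk))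
      congr 1 <;> ring
    linear_combination h

theorem sum_raise_projKernel_mul {d M n : ℕ} (hn : n ≤ M + 1) {y : Fin (d + 1) → ℕ}
    (hy : y ∈ ZN d (M + 1)) (g : (Fin (d + 1) → ℕ) → ℝ) :
    ∑ γ ∈ ZN d M, raise (projKernel d (M + 1) n y) γ * raise g γ =
      (((M + 1 : ℕ) : ℝ) - n) * ((M + 1 : ℕ) + n + d) *
        ∑ x ∈ ZN d (M + 1), projKernel d (M + 1) n y x * g x := by
  set N := M + 1 with hN
  have hr : ∀ γ ∈ ZN d M, raise (projKernel d N n y) γ =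
      ∑ k ∈ range (N + 1), (projCoeff d N n k * (N + d + k) +
        projCoeff d N n (k + 1) * (N - k)) * chooseKernel d k y γ := by
    intro γ hγ
    have h1 : raise (projKernel d N n y) γ = _ :=
      raise_sum (range (N + 1)) (projCoeff d N n) (fun k z => chooseKernel d k y z) γ
    rw [h1, sum_range_succ']
    simp only [add_mul (projCoeff d N n _ * _), sum_add_distrib]
    rw [sum_range_succ' (fun k => projCoeff d N n k * ((N : ℝ) + d + k) * chooseKernel d k y γ),
      sum_range_succ (fun k => projCoeff d N n (k + 1) * ((N : ℝ) - k) * chooseKernel d k y γ)]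
    simp only [raise_chooseKernel_succ, raise_chooseKernel_zero, mem_ZN.mp hγ, mem_ZN.mp hy,
      mul_add, sum_add_distrib]
    have hNM : (N : ℝ) = M + 1 := by rw [hN]; push_cast; ring
    simp only [hNM]
    push_cast
    rw [add_right_comm, sub_self, mul_zero (projCoeff d N n (N + 1)), zero_mul,
      add_zero (Finset.sum _ _)]
    congr 1
    · congr 1
      · exact sum_congr rfl fun k _ => by ring
      · ring
    · exact sum_congr rfl fun k _ => by ring
  rw [sum_congr rfl fun γ hγ => by rw [hr γ hγ], ← sum_lower_mul, mul_sum]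
  refine sum_congr rfl fun x hx => ?_
  rw [lower_sum (f := fun k z => chooseKernel d k y z), projKernel, sum_mul, sum_mul, mul_sum]
  refine sum_congr rfl fun k hk => ?_
  rw [lower_chooseKernel, mem_ZN.mp hx]
  have := projCoeff_rec (d := d) hn (Nat.le_of_lt_succ (mem_range.mp hk))
  linear_combination chooseKernel d k y x * g x * this

theorem sum_projKernel_mul_of_ne {d M n m : ℕ} (hn : n ≤ M + 1) (hm : m ≤ M + 1) (hnm : n ≠ m)
    {y z : Fin (d + 1) → ℕ} (hy : y ∈ ZN d (M + 1)) (hz : z ∈ ZN d (M + 1)) :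
    ∑ x ∈ ZN d (M + 1), projKernel d (M + 1) n y x * projKernel d (M + 1) m z x = 0 := by
  have h1 := sum_raise_projKernel_mul hn hy (projKernel d (M + 1) m z)
  have h2 := sum_raise_projKernel_mul hm hz (projKernel d (M + 1) n y)
  simp only [mul_comm (raise (projKernel d (M + 1) m z) _),
    mul_comm (projKernel d (M + 1) m z _)] at h2
  rw [h1] at h2
  have hne : ((n : ℝ) - m) * (n + m + d) ≠ 0 := by
    refine mul_ne_zero (sub_ne_zero.mpr (by exact_mod_cast hnm)) ?_
    have : 0 < n + m + d := by omega
    exact_mod_cast this.ne'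
  refine (mul_eq_zero.mp ?_).resolve_left hne
  linear_combination -h2

theorem sum_projKernel_mul_self {d M n : ℕ} (hd : 1 ≤ d) (hn : n ≤ M + 1)
    {y z : Fin (d + 1) → ℕ} (hy : y ∈ ZN d (M + 1)) (hz : z ∈ ZN d (M + 1)) :
    ∑ x ∈ ZN d (M + 1), projKernel d (M + 1) n y x * projKernel d (M + 1) n z x =
      projKernel d (M + 1) n y z := by
  have h : ∑ m ∈ range (M + 1 + 1),
      ∑ x ∈ ZN d (M + 1), projKernel d (M + 1) n y x * projKernel d (M + 1) m z x =
        projKernel d (M + 1) n y z := by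
    rw [sum_comm]
    simp only [← mul_sum]
    rw [sum_eq_single_of_mem z hz, sum_projKernel hd hz hz, if_pos rfl, mul_one]
    intro x hx hne
    rw [sum_projKernel hd hz hx, if_neg hne.symm, mul_zero]
  rw [← h, sum_eq_single_of_mem n (mem_range.mpr (by omega))]
  intro m hm hne
  exact sum_projKernel_mul_of_ne hn (Nat.le_of_lt_succ (mem_range.mp hm)) hne.symm hy hz

theorem sum_sq_projKernel {d M n : ℕ} (hd : 1 ≤ d) (hn : n ≤ M + 1)
    (x : (Fin (d + 1) → ℕ) → ℝ) :
    ∑ α ∈ ZN d (M + 1), (∑ β ∈ ZN d (M + 1), x β * projKernel d (M + 1) n α β) ^ 2 =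
      ∑ β ∈ ZN d (M + 1), ∑ β' ∈ ZN d (M + 1), x β * x β' * projKernel d (M + 1) n β β' := by
  simp only [sq, sum_mul_sum]
  rw [sum_comm]
  refine sum_congr rfl fun β hβ => ?_
  rw [sum_comm]
  refine sum_congr rfl fun β' hβ' => ?_
  rw [← sum_projKernel_mul_self hd hn hβ hβ', mul_sum]
  refine sum_congr rfl fun α _ => ?_
  rw [projKernel_comm d _ n α β, projKernel_comm d _ n α β']
  ring

/-- the vectors `q_0` and `q_{α,n}` (with κ = 0) form a tight frame of
`ℝ^{n(d,N)}`. -/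
theorem monicQn_tight_frame (d N : ℕ) (hd : 1 ≤ d) (hN : 1 ≤ N)
    (x : (Fin (d + 1) → ℕ) → ℝ) :
    ∑ β ∈ ZN d N, x β ^ 2 =
      (∑ β ∈ ZN d N, x β * Real.sqrt ((Nat.factorial N : ℝ) / poch ((d : ℝ) + 1) N)) ^ 2 +
        ∑ n ∈ Finset.Icc 1 N, ∑ α ∈ ZN d N,
          (∑ β ∈ ZN d N,
              x β * monicQn d N (fun _ => 0) α n (fun i => (β i : ℝ))) ^ 2 := by
  obtain ⟨M, rfl⟩ : ∃ M, N = M + 1 := ⟨N - 1, by omega⟩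
  have hzero : (∑ β ∈ ZN d (M + 1),
        x β * Real.sqrt (((M + 1).factorial : ℝ) / poch ((d : ℝ) + 1) (M + 1))) ^ 2 =
      ∑ β ∈ ZN d (M + 1), ∑ β' ∈ ZN d (M + 1), x β * x β' * projKernel d (M + 1) 0 β β' := by
    have hp := poch_pos (a := (d : ℝ) + 1) (by positivity) (M + 1)
    rw [← sum_mul, mul_pow, Real.sq_sqrt (by positivity), sq, sum_mul_sum]
    simp only [projKernel_zero, sum_mul]
  have hpos : ∑ n ∈ Icc 1 (M + 1), ∑ α ∈ ZN d (M + 1), (∑ β ∈ ZN d (M + 1),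
        x β * monicQn d (M + 1) (fun _ => 0) α n (fun i => (β i : ℝ))) ^ 2 =
      ∑ n ∈ Icc 1 (M + 1), ∑ β ∈ ZN d (M + 1), ∑ β' ∈ ZN d (M + 1),
        x β * x β' * projKernel d (M + 1) n β β' := by
    refine sum_congr rfl fun n hn => ?_
    have hnN := (mem_Icc.mp hn).2
    rw [← sum_sq_projKernel hd hnN]
    refine sum_congr rfl fun α hα => ?_
    simp only [monicQn_eq_projKernel hd hnN hα]
  rw [hzero, hpos]
  have hsplit (f : ℕ → ℝ) : f 0 + ∑ n ∈ Icc 1 (M + 1), f n = ∑ n ∈ range (M + 1 + 1), f n := by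
    rw [range_eq_Ico, sum_eq_sum_Ico_succ_bot (Nat.succ_pos _)]
    rfl
  rw [hsplit (fun n => ∑ β ∈ ZN d (M + 1), ∑ β' ∈ ZN d (M + 1),
    x β * x β' * projKernel d (M + 1) n β β'), sum_comm]
  refine sum_congr rfl fun β hβ => ?_
  rw [sum_comm]
  simp only [← mul_sum]
  rw [sum_eq_single_of_mem β hβ, sum_projKernel hd hβ hβ, if_pos rfl, mul_one, sq]
  intro β' hβ' hne
  rw [sum_projKernel hd hβ hβ', if_neg hne.symm, mul_zero]
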